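/- The series ∑_{m=1}^∞ (-1)^m · m³ / C(2m, m) converges and equals (2/625)·(14·σ + 5), where σ = √5 · log((1 + √5)/2). -/

import Mathlib

theorem lehmer_int_rec (m : ℕ) :
    ((m : ℝ) + 1) * (∫ x in (0:ℝ)..1, (x * (1 - x)) ^ m)
      = (2 + 4 * ((m : ℝ) + 1)) * ∫ x in (0:ℝ)..1, (x * (1 - x)) ^ (m + 1) := by
  have h : ∫ x in (0:ℝ)..1, (((m : ℝ) + 1) * (x * (1 - x)) ^ m
      - (2 + 4 * ((m : ℝ) + 1)) * (x * (1 - x)) ^ (m + 1)) = 0 := by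
    rw [intervalIntegral.integral_eq_sub_of_hasDerivAt
      (f := fun x : ℝ => (1 - 2 * x) * (x * (1 - x)) ^ (m + 1))]
    · simp
    · intro x _
      have h1 : HasDerivAt (fun x : ℝ => 1 - 2 * x) (-2) x := by
        simpa using ((hasDerivAt_id x).const_mul 2).const_sub 1
      have h2 : HasDerivAt (fun x : ℝ => x * (1 - x)) (1 - 2 * x) x := by
        have := (hasDerivAt_id x).mul ((hasDerivAt_id x).const_sub 1)
        refine this.congr_deriv ?_
        simp
        ring
      refine (h1.mul (h2.pow (m + 1))).congr_deriv ?_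
      push_cast
      simp only [Pi.pow_apply]
      ring
    · exact Continuous.intervalIntegrable (by fun_prop) _ _
  rw [intervalIntegral.integral_sub, intervalIntegral.integral_const_mul,
    intervalIntegral.integral_const_mul] at h
  · linarith
  · exact Continuous.intervalIntegrable (by fun_prop) _ _
  · exact Continuous.intervalIntegrable (by fun_prop) _ _

theorem lehmer_cb_rec (m : ℕ) :
    ((m : ℝ) + 1) * (Nat.centralBinom (m + 1) : ℝ)
      = 2 * (2 * m + 1) * (Nat.centralBinom m : ℝ) := by
  exact_mod_cast Nat.succ_mul_centralBinom_succ m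

theorem lehmer_cb_pos (m : ℕ) : (0 : ℝ) < (Nat.centralBinom m : ℝ) := by
  exact_mod_cast Nat.centralBinom_pos m

theorem lehmer_int (m : ℕ) :
    (∫ x in (0:ℝ)..1, (x * (1 - x)) ^ m) * ((2 * m + 1) * (Nat.centralBinom m : ℝ)) = 1 := by
  induction m with
  | zero => simp
  | succ m ih =>
    have h1 := lehmer_int_rec m
    have h2 := lehmer_cb_rec m
    set I := ∫ x in (0:ℝ)..1, (x * (1 - x)) ^ m
    set J := ∫ x in (0:ℝ)..1, (x * (1 - x)) ^ (m + 1)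
    have hm : (0 : ℝ) < (m : ℝ) + 1 := by positivity
    have : ((m : ℝ) + 1) * (J * ((2 * ((m : ℝ) + 1) + 1) * (Nat.centralBinom (m + 1) : ℝ)) - 1)
        = 0 := by
      linear_combination (J * (2 * ((m : ℝ) + 1) + 1)) * h2
        - ((2 * m + 1) * (Nat.centralBinom m : ℝ)) * h1 + ((m : ℝ) + 1) * ih
    rcases mul_eq_zero.1 this with h | h
    · exact absurd h hm.ne'
    · push_cast
      linarith

theorem lehmer_integral :
    ∫ x in (0:ℝ)..1, (1 + x * (1 - x))⁻¹
      = 4 / √5 * Real.log ((1 + √5) / 2) := by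
  have hs : √5 * √5 = (5 : ℝ) := Real.mul_self_sqrt (by norm_num)
  have hs2 : (2 : ℝ) < √5 := by
    rw [Real.lt_sqrt (by norm_num)]; norm_num
  set s := √5
  rw [intervalIntegral.integral_eq_sub_of_hasDerivAt
      (f := fun x : ℝ => (1 / s) * (Real.log (s - 1 + 2 * x) - Real.log (s + 1 - 2 * x)))]
  · have e : s - 1 = 4 / (s + 1) := by
      field_simp
      linarith
    have l1 : Real.log (s - 1) = 2 * Real.log 2 - Real.log (s + 1) := by
      rw [e, Real.log_div (by norm_num) (by linarith),
        show (4 : ℝ) = 2 ^ 2 by norm_num, Real.log_pow]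
      norm_num
    have l2 : Real.log ((1 + s) / 2) = Real.log (s + 1) - Real.log 2 := by
      rw [Real.log_div (by linarith) (by norm_num), add_comm]
    rw [l2]
    have e1 : s - 1 + 2 * 1 = s + 1 := by ring
    have e2 : s + 1 - 2 * 1 = s - 1 := by ring
    simp only [e1, e2, mul_zero, add_zero, sub_zero, l1]
    ring
  · intro x hx
    rw [Set.uIcc_of_le (by norm_num)] at hx
    obtain ⟨h0, h1⟩ := hx
    have p1 : 0 < s - 1 + 2 * x := by linarith
    have p2 : 0 < s + 1 - 2 * x := by linarith
    have p3 : 0 < 1 + x * (1 - x) := by nlinarith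
    have d1 : HasDerivAt (fun x : ℝ => s - 1 + 2 * x) 2 x := by
      simpa using ((hasDerivAt_id x).const_mul 2).const_add (s - 1)
    have d2 : HasDerivAt (fun x : ℝ => s + 1 - 2 * x) (-2) x := by
      simpa using ((hasDerivAt_id x).const_mul 2).const_sub (s + 1)
    refine (((d1.log p1.ne').sub (d2.log p2.ne')).const_mul (1 / s)).congr_deriv ?_
    have e : (s - 1 + 2 * x) * (s + 1 - 2 * x) = 4 * (1 + x * (1 - x)) := by
      linear_combination hs
    have : 2 / (s - 1 + 2 * x) - -2 / (s + 1 - 2 * x)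
        = 4 * s / ((s - 1 + 2 * x) * (s + 1 - 2 * x)) := by
      field_simp
      ring
    rw [this, e]
    field_simp
  · apply ContinuousOn.intervalIntegrable
    apply ContinuousOn.inv₀ (by fun_prop)
    intro x hx
    rw [Set.uIcc_of_le (by norm_num)] at hx
    obtain ⟨h0, h1⟩ := hx
    nlinarith

theorem lehmer_base :
    HasSum (fun m : ℕ => (-1 : ℝ) ^ m / ((2 * m + 1) * (Nat.centralBinom m : ℝ)))
      (4 / √5 * Real.log ((1 + √5) / 2)) := by
  rw [← lehmer_integral]
  have key : ∀ m : ℕ, (-1 : ℝ) ^ m / ((2 * m + 1) * (Nat.centralBinom m : ℝ))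
      = ∫ x in (0:ℝ)..1, (-(x * (1 - x))) ^ m := by
    intro m
    have h := lehmer_int m
    have hp := lehmer_cb_pos m
    have : ∀ x : ℝ, (-(x * (1 - x))) ^ m = (-1) ^ m * (x * (1 - x)) ^ m := fun x => neg_pow _ _
    simp only [this]
    rw [intervalIntegral.integral_const_mul, div_eq_iff (by positivity), mul_assoc, h, mul_one]
  simp only [key]
  have bd : ∀ x ∈ Set.uIoc (0:ℝ) 1, ‖-(x * (1 - x))‖ ≤ 1 / 4 := by
    intro x hx
    rw [Set.uIoc_of_le (by norm_num)] at hx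
    obtain ⟨h0, h1⟩ := hx
    rw [norm_neg, Real.norm_eq_abs, abs_le]
    constructor <;> nlinarith [sq_nonneg (2 * x - 1)]
  apply intervalIntegral.hasSum_integral_of_dominated_convergence
    (fun (m : ℕ) (_ : ℝ) => (1 / 4 : ℝ) ^ m)
  · intro m
    exact Continuous.aestronglyMeasurable (by fun_prop)
  · intro m
    filter_upwards with x hx
    rw [norm_pow]
    exact pow_le_pow_left₀ (norm_nonneg _) (bd x hx) m
  · filter_upwards with x hx
    exact summable_geometric_of_lt_one (by norm_num) (by norm_num)
  · exact intervalIntegrable_const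
  · filter_upwards with x hx
    have := hasSum_geometric_of_norm_lt_one (ξ := -(x * (1 - x)))
      ((bd x hx).trans_lt (by norm_num))
    rwa [sub_neg_eq_add] at this

theorem lehmer_summable (k : ℕ) :
    Summable (fun m : ℕ => (m : ℝ) ^ k * ((-1 : ℝ) ^ m / (Nat.centralBinom m : ℝ))) := by
  rw [← summable_nat_add_iff 1]
  have h := ((summable_pow_mul_geometric_of_norm_lt_one (k + 1) (r := (1 / 4 : ℝ))
    (by norm_num)).mul_left 2)
  rw [← summable_nat_add_iff 1] at h
  refine Summable.of_norm_bounded h ?_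
  intro m
  have hb : (4 : ℝ) ^ (m + 1) ≤ 2 * ((m + 1 : ℕ) : ℝ) * (Nat.centralBinom (m + 1) : ℝ) := by
    exact_mod_cast Nat.four_pow_le_two_mul_self_mul_centralBinom (m + 1) (Nat.succ_pos m)
  have hp := lehmer_cb_pos (m + 1)
  rw [norm_mul, norm_div, norm_pow, norm_pow, norm_neg, norm_one, one_pow,
    Real.norm_of_nonneg hp.le, Real.norm_of_nonneg (by positivity)]
  have : 1 / (Nat.centralBinom (m + 1) : ℝ) ≤ 2 * ((m + 1 : ℕ) : ℝ) * (1 / 4) ^ (m + 1) := by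
    rw [div_pow, one_pow, mul_one_div, div_le_div_iff₀ hp (by positivity)]
    linarith
  calc _ ≤ ((m + 1 : ℕ) : ℝ) ^ k * (2 * ((m + 1 : ℕ) : ℝ) * (1 / 4) ^ (m + 1)) := by gcongr
    _ = _ := by ring

/-- ∑_{m=1}^∞ (-1)^m · m³ / C(2m, m) converges and equals (2/625)·(14·σ + 5), where
σ = √5 · log((1 + √5)/2). -/
theorem lehmer_corrected_p455 :
    HasSum (fun m : ℕ =>
      (-1 : ℝ) ^ (m + 1) * ((m : ℝ) + 1) ^ 3 / (Nat.choose (2 * (m + 1)) (m + 1) : ℝ))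
      (2 / 625 * (14 * (Real.sqrt 5 * Real.log ((1 + Real.sqrt 5) / 2)) + 5)) := by
  let c : ℕ → ℝ := fun m => (-2 / 125 + 2 / 5 * (m : ℝ) + 14 / 25 * (m : ℝ) ^ 2
    - 4 / 5 * (m : ℝ) ^ 3) * ((-1 : ℝ) ^ m / (Nat.centralBinom m : ℝ))
  have hc : Summable c := by
    have := (((lehmer_summable 0).mul_left (-2 / 125)).add
      ((lehmer_summable 1).mul_left (2 / 5))).add
      (((lehmer_summable 2).mul_left (14 / 25)).add ((lehmer_summable 3).mul_left (-4 / 5)))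
    refine this.congr ?_
    intro m
    simp only [c]
    ring
  have hc1 : HasSum (fun m => c (m + 1)) (∑' m, c m - c 0) := by
    have := (hasSum_nat_add_iff' 1).2 hc.hasSum
    simpa using this
  have hd := (lehmer_base.mul_left (7 / 125)).add (hc1.sub hc.hasSum)
  have hf : HasSum (fun m : ℕ => (-1 : ℝ) ^ m * (m : ℝ) ^ 3 / (Nat.choose (2 * m) m : ℝ))
      (2 / 625 * (14 * (Real.sqrt 5 * Real.log ((1 + Real.sqrt 5) / 2)) + 5)) := by
    convert hd using 1
    · rfl
    · funext m
      simp only [c]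
      have h1 := lehmer_cb_rec m
      have hp := lehmer_cb_pos m
      have hm : (0 : ℝ) < (m : ℝ) + 1 := by positivity
      have h2 : (Nat.centralBinom (m + 1) : ℝ)
          = 2 * (2 * m + 1) * (Nat.centralBinom m : ℝ) / ((m : ℝ) + 1) := by
        rw [eq_div_iff hm.ne']; linarith
      rw [← Nat.centralBinom_eq_two_mul_choose, h2]
      push_cast
      field_simp
      ring
    · have hs : √5 * √5 = (5 : ℝ) := Real.mul_self_sqrt (by norm_num)
      have h0 : √5 ≠ (0 : ℝ) := by positivity
      have e : 4 / √5 = 4 / 5 * √5 := by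
        rw [div_eq_iff h0]; linarith
      rw [e]
      simp [c]
      ring
  have := (hasSum_nat_add_iff' 1).2 hf
  simpa using this
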